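/- Consider the perturbed ridge problem P₁(μ) = min_{u ∈ ℝ^d} (1/n)‖y − (1/√d)X(u ⊙ v)‖₂² + (λ/d)‖u‖₂² + (μ/d)∑_{i=1}^d h(u_i, v_i, θ*_i), where h : ℝ³ → ℝ is twice continuously differentiable with uniformly bounded Hessian norm ‖∇²h‖ ≤ C, h is either uniformly bounded or h(u,v,θ) = u², and |μ| ≤ λ/C so the objective is strongly convex with unique minimizer u*. Let Δ* = (1/√d)(u* ⊙ v − θ*) and q* = (1/√n)(ε − XΔ*). Then there exists a constant C₁ > 0 (independent of d) such that, as n, d → ∞ with d/n = κ fixed, P{‖Δ*‖₂ ≤ C₁(1 + ‖v‖_∞)} → 1 and P{‖q*‖₂ ≤ C₁(1 + ‖v‖_∞)} → 1. -/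

import Mathlib

open MeasureTheory ProbabilityTheory Filter Topology NNReal ENNReal

noncomputable section

/-- A function `g : ℝ² → ℝ` is pseudo-Lipschitz of order 2 (PL(2)) with respect to the
Euclidean norm on ℝ². -/
def PseudoLipschitz2Pair (g : ℝ × ℝ → ℝ) : Prop :=
  ∃ C > (0 : ℝ), ∀ x y : ℝ × ℝ,
    |g x - g y| ≤
      C * (1 + Real.sqrt (x.1 ^ 2 + x.2 ^ 2) + Real.sqrt (y.1 ^ 2 + y.2 ^ 2)) *
        Real.sqrt ((x.1 - y.1) ^ 2 + (x.2 - y.2) ^ 2)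

/-- The distribution of a batch `(X, ε)`, where `X ∈ ℝ^{n×d}` has i.i.d. `N(0,1)` entries and
`ε ~ N(0, σ² I_n)`. -/
def batchMeasure (n d : ℕ) (σ : ℝ≥0) :
    Measure ((Fin n → Fin d → ℝ) × (Fin n → ℝ)) :=
  (Measure.pi fun _ : Fin n => Measure.pi fun _ : Fin d => gaussianReal 0 1).prod
    (Measure.pi fun _ : Fin n => gaussianReal 0 (σ ^ 2))


def pbad (n : ℕ) : ℝ≥0∞ :=
  (Measure.pi fun _ : Fin n => gaussianReal 0 1) {g | 2 * (n : ℝ) ≤ ∑ i, g i ^ 2}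

lemma memLp_sq_gauss : MemLp (fun x : ℝ => x ^ 2) 2 (gaussianReal 0 1) := by
  have h4 : MemLp (id : ℝ → ℝ) 4 (gaussianReal 0 1) := memLp_id_gaussianReal' 4 (by simp)
  have : HolderTriple (4 : ℝ≥0∞) 4 2 := ⟨by
    rw [← two_mul, show (4 : ℝ≥0∞) = 2 * 2 by norm_num,
      ENNReal.mul_inv (by simp) (by simp), ← mul_assoc, ENNReal.mul_inv_cancel (by simp) (by simp),
      one_mul]⟩
  have := h4.mul (r := 2) h4
  convert this using 1
  ext x; simp [sq]

lemma integral_sq_gauss : ∫ x : ℝ, x ^ 2 ∂(gaussianReal 0 1) = 1 := by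
  have h := variance_fun_id_gaussianReal (μ := 0) (v := 1)
  rw [variance_eq_integral (by fun_prop)] at h
  simpa [integral_id_gaussianReal] using h

lemma tendsto_pbad : Tendsto pbad atTop (𝓝 0) := by
  set K := Var[fun x : ℝ => x ^ 2; gaussianReal 0 1] with hK
  have hb : ∀ n : ℕ, 0 < n → pbad n ≤ ENNReal.ofReal (K / n) := by
    intro n hn
    have hn' : (0 : ℝ) < n := by exact_mod_cast hn
    have hm : ∀ i : Fin n, MemLp (fun g : Fin n → ℝ => g i ^ 2) 2
        (Measure.pi fun _ : Fin n => gaussianReal 0 1) := fun i =>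
      memLp_sq_gauss.comp_measurePreserving
        (measurePreserving_eval (fun _ : Fin n => gaussianReal 0 1) i)
    have hX : MemLp (∑ i, fun g : Fin n → ℝ => g i ^ 2) 2
        (Measure.pi fun _ : Fin n => gaussianReal 0 1) := memLp_finsetSum' _ (fun i _ => hm i)
    have hv := variance_sum_pi (μ := fun _ : Fin n => gaussianReal 0 1)
      (X := fun _ x => x ^ 2) (fun _ => memLp_sq_gauss)
    have hE : ∫ g : Fin n → ℝ, (∑ i, fun g : Fin n → ℝ => g i ^ 2) g
        ∂(Measure.pi fun _ : Fin n => gaussianReal 0 1) = n := by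
      simp only [Finset.sum_apply]
      rw [integral_finsetSum _ (fun i _ => (hm i).integrable (by norm_num))]
      have : ∀ i : Fin n, ∫ g : Fin n → ℝ, g i ^ 2
          ∂(Measure.pi fun _ : Fin n => gaussianReal 0 1) = 1 := fun i => by
        rw [integral_comp_eval (μ := fun _ : Fin n => gaussianReal 0 1) (f := fun x => x ^ 2)
          (by fun_prop), integral_sq_gauss]
      simp [this]
    have := meas_ge_le_variance_div_sq hX hn'
    rw [hE, hv] at this
    refine (measure_mono ?_).trans (this.trans (ENNReal.ofReal_le_ofReal ?_))
    · intro g hg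
      simp only [Set.mem_ofPred_eq, Finset.sum_apply] at hg ⊢
      exact le_trans (by linarith) (le_abs_self _)
    · simp only [Finset.sum_const, Finset.card_univ, Fintype.card_fin, nsmul_eq_mul]
      rw [← hK]
      apply le_of_eq; field_simp
  have hlim : Tendsto (fun n : ℕ => ENNReal.ofReal (K / n)) atTop (𝓝 0) := by
    have := ENNReal.tendsto_ofReal (tendsto_const_div_atTop_nhds_zero_nat K)
    simpa using this
  refine tendsto_of_tendsto_of_tendsto_of_le_of_le' tendsto_const_nhds hlim
    (Eventually.of_forall fun _ => zero_le) ?_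
  filter_upwards [eventually_gt_atTop 0] with n hn using hb n hn

lemma gauss_eq_map (v : ℝ≥0) :
    gaussianReal 0 v = (gaussianReal 0 1).map (fun x => Real.sqrt v * x) := by
  rw [gaussianReal_map_const_mul]
  congr 1
  · simp
  · ext; simp

lemma bad_gauss (n : ℕ) (v : ℝ≥0) :
    (Measure.pi fun _ : Fin n => gaussianReal 0 v) {z | 2 * (n : ℝ) * v < ∑ i, z i ^ 2}
      ≤ pbad n := by
  have hms : MeasurableSet {z : Fin n → ℝ | 2 * (n : ℝ) * v < ∑ i, z i ^ 2} :=
    measurableSet_lt (by fun_prop) (by fun_prop)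
  have : ∀ i : Fin n, SigmaFinite ((gaussianReal 0 1).map (fun x => Real.sqrt v * x)) := fun i => by
    rw [← gauss_eq_map]; infer_instance
  have := Measure.pi_map_pi (μ := fun _ : Fin n => gaussianReal 0 1)
    (f := fun _ x => Real.sqrt v * x) (fun i => by fun_prop)
  simp_rw [← gauss_eq_map] at this
  rw [← this, Measure.map_apply (by fun_prop) hms]
  refine measure_mono ?_
  intro g hg
  simp only [Set.mem_preimage, Set.mem_ofPred_eq, mul_pow, Real.sq_sqrt v.coe_nonneg, ← Finset.mul_sum] at hg ⊢
  rcases eq_or_lt_of_le v.coe_nonneg with h0 | h0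
  · rw [← h0] at hg; simp at hg
  · by_contra hcon
    push Not at hcon
    nlinarith [mul_lt_mul_of_pos_left hcon h0]

lemma law_linear (d : ℕ) (a : Fin d → ℝ) :
    (Measure.pi fun _ : Fin d => gaussianReal 0 1).map (fun x => ∑ k, x k * a k)
      = gaussianReal 0 (Real.toNNReal (∑ k, a k ^ 2)) := by
  have hG : IsGaussian (Measure.pi fun _ : Fin d => gaussianReal 0 1) := by
    have := (iIndepFun.hasGaussianLaw (P := Measure.pi fun _ : Fin d => gaussianReal 0 1)
      (X := fun i (x : Fin d → ℝ) => x i) (fun i => ⟨by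
        rw [(measurePreserving_eval (fun _ : Fin d => gaussianReal 0 1) i).map_eq]; infer_instance⟩)
      (iIndepFun_pi (X := fun _ => id) (fun _ => aemeasurable_id))).isGaussian_map
    simpa using this
  let L : StrongDual ℝ (Fin d → ℝ) := ∑ k, a k • ContinuousLinearMap.proj k
  have hL : ⇑L = fun x => ∑ k, x k * a k := by
    ext x; simp [L, mul_comm]
  have h := hG.map_eq_gaussianReal L
  rw [hL] at h
  rw [h]
  have hm : ∀ k, MemLp (fun x : ℝ => x * a k) 2 (gaussianReal 0 1) := fun k =>
    (memLp_id_gaussianReal' 2 (by simp)).mul_const (a k)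
  congr 1
  · rw [integral_finsetSum]
    · refine Finset.sum_eq_zero fun k _ => ?_
      rw [integral_mul_const, integral_comp_eval (μ := fun _ : Fin d => gaussianReal 0 1)
        (f := fun x => x) (by fun_prop), integral_id_gaussianReal, zero_mul]
    · intro k _
      exact integrable_comp_eval (μ := fun _ : Fin d => gaussianReal 0 1)
        (f := fun x => x * a k) ((hm k).integrable (by norm_num))
  · congr 1
    have hv := variance_sum_pi (μ := fun _ : Fin d => gaussianReal 0 1)
      (X := fun k x => x * a k) hm
    have he : (∑ k, fun x : Fin d → ℝ => x k * a k) = fun x => ∑ k, x k * a k := by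
      ext x; simp
    rw [he] at hv
    rw [hv]
    refine Finset.sum_congr rfl fun k _ => ?_
    rw [variance_mul_const, variance_fun_id_gaussianReal]; simp

lemma bad_rows (n d : ℕ) (a : Fin d → ℝ) :
    (Measure.pi fun _ : Fin n => Measure.pi fun _ : Fin d => gaussianReal 0 1)
      {X | 2 * (n : ℝ) * (∑ k, a k ^ 2) < ∑ i, (∑ k, X i k * a k) ^ 2} ≤ pbad n := by
  have hs : (0 : ℝ) ≤ ∑ k, a k ^ 2 := Finset.sum_nonneg fun _ _ => sq_nonneg _
  have h1 := bad_gauss n (Real.toNNReal (∑ k, a k ^ 2))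
  have hms : MeasurableSet {z : Fin n → ℝ |
      2 * (n : ℝ) * (Real.toNNReal (∑ k, a k ^ 2)) < ∑ i, z i ^ 2} :=
    measurableSet_lt (by fun_prop) (by fun_prop)
  have : ∀ i : Fin n, SigmaFinite ((Measure.pi fun _ : Fin d => gaussianReal 0 1).map
      (fun x => ∑ k, x k * a k)) := fun i => by
    rw [law_linear]; infer_instance
  have := Measure.pi_map_pi (μ := fun _ : Fin n => Measure.pi fun _ : Fin d => gaussianReal 0 1)
    (f := fun _ x => ∑ k, x k * a k)
    (fun i => Measurable.aemeasurable (by fun_prop))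
  simp_rw [law_linear] at this
  rw [← this, Measure.map_apply (by fun_prop) hms] at h1
  simpa [Real.coe_toNNReal _ hs] using h1

lemma bad_batch (n d : ℕ) (σ : ℝ≥0) (a : Fin d → ℝ) :
    batchMeasure n d σ {ω | 4 * (n : ℝ) * ((∑ k, a k ^ 2) + (σ : ℝ) ^ 2)
      < ∑ i, ((∑ k, ω.1 i k * a k) + ω.2 i) ^ 2} ≤ pbad n + pbad n := by
  let A : Set (Fin n → Fin d → ℝ) :=
    {X | 2 * (n : ℝ) * (∑ k, a k ^ 2) < ∑ i, (∑ k, X i k * a k) ^ 2}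
  let B : Set (Fin n → ℝ) := {z | 2 * (n : ℝ) * ((σ ^ 2 : ℝ≥0) : ℝ) < ∑ i, z i ^ 2}
  have hsub : {ω : (Fin n → Fin d → ℝ) × (Fin n → ℝ) |
      4 * (n : ℝ) * ((∑ k, a k ^ 2) + (σ : ℝ) ^ 2)
      < ∑ i, ((∑ k, ω.1 i k * a k) + ω.2 i) ^ 2} ⊆ A ×ˢ Set.univ ∪ Set.univ ×ˢ B := by
    intro ω hω
    by_contra hcon
    simp only [A, B, Set.mem_union, Set.mem_prod, Set.mem_univ, Set.mem_ofPred_eq, and_true,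
      true_and, not_or, not_lt, NNReal.coe_pow] at hcon hω
    have : ∑ i, ((∑ k, ω.1 i k * a k) + ω.2 i) ^ 2
        ≤ ∑ i, (2 * (∑ k, ω.1 i k * a k) ^ 2 + 2 * ω.2 i ^ 2) :=
      Finset.sum_le_sum fun i _ => by nlinarith [sq_nonneg ((∑ k, ω.1 i k * a k) - ω.2 i)]
    rw [Finset.sum_add_distrib, ← Finset.mul_sum, ← Finset.mul_sum] at this
    nlinarith [hcon.1, hcon.2]
  refine (measure_mono hsub).trans ((measure_union_le _ _).trans ?_)
  unfold batchMeasure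
  rw [Measure.prod_prod, Measure.prod_prod, measure_univ, measure_univ, mul_one, one_mul]
  exact add_le_add (bad_rows n d a) (bad_gauss n (σ ^ 2))

lemma pl_sq_snd : PseudoLipschitz2Pair (fun p => p.2 ^ 2) := by
  refine ⟨1, one_pos, fun x y => ?_⟩
  have hx : |x.2| ≤ Real.sqrt (x.1 ^ 2 + x.2 ^ 2) :=
    Real.abs_le_sqrt (by nlinarith [sq_nonneg x.1])
  have hy : |y.2| ≤ Real.sqrt (y.1 ^ 2 + y.2 ^ 2) :=
    Real.abs_le_sqrt (by nlinarith [sq_nonneg y.1])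
  have hxy : |x.2 - y.2| ≤ Real.sqrt ((x.1 - y.1) ^ 2 + (x.2 - y.2) ^ 2) :=
    Real.abs_le_sqrt (by nlinarith [sq_nonneg (x.1 - y.1)])
  have : x.2 ^ 2 - y.2 ^ 2 = (x.2 + y.2) * (x.2 - y.2) := by ring
  simp only [this, abs_mul]
  have := abs_add_le x.2 y.2
  refine mul_le_mul (by linarith) hxy (abs_nonneg _) (by positivity)

lemma two_le_hess (C : ℝ)
    (hhess : ∀ x, ‖iteratedFDeriv ℝ 2 (fun x : ℝ × ℝ × ℝ => x.1 ^ 2) x‖ ≤ C) : 2 ≤ C := by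
  have h1 : fderiv ℝ (fun x : ℝ × ℝ × ℝ => x.1 ^ 2) =
      fun x => (2 * x.1) • ContinuousLinearMap.fst ℝ ℝ (ℝ × ℝ) := by
    ext1 x
    have := ((hasFDerivAt_fst (𝕜 := ℝ) (p := x)).pow 2).fderiv
    rw [this]
    simp
  have h2 : fderiv ℝ (fun x : ℝ × ℝ × ℝ => (2 * x.1) • ContinuousLinearMap.fst ℝ ℝ (ℝ × ℝ)) 0
      ((1 : ℝ), (0 : ℝ), (0 : ℝ)) = (2 : ℝ) • ContinuousLinearMap.fst ℝ ℝ (ℝ × ℝ) := by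
    have := (((hasFDerivAt_fst (𝕜 := ℝ) (p := (0 : ℝ × ℝ × ℝ))).const_mul (2 : ℝ)).smul_const
      (ContinuousLinearMap.fst ℝ ℝ (ℝ × ℝ))).fderiv
    rw [this]
    simp
  have h3 := (iteratedFDeriv ℝ 2 (fun x : ℝ × ℝ × ℝ => x.1 ^ 2) 0).le_opNorm
    (fun _ => ((1 : ℝ), (0 : ℝ), (0 : ℝ)))
  rw [iteratedFDeriv_two_apply, h1, h2] at h3
  simp [Prod.norm_def] at h3
  exact h3.trans (hhess 0)

lemma penalty_bound (lam : ℝ) (hlam : 0 < lam) (h : ℝ × ℝ × ℝ → ℝ) (C : ℝ) (hC : 0 < C)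
    (hhess : ∀ x, ‖iteratedFDeriv ℝ 2 h x‖ ≤ C)
    (hshape : (∃ B : ℝ, ∀ x, |h x| ≤ B) ∨ h = fun x => x.1 ^ 2)
    (μ : ℝ) (hμ : |μ| ≤ lam / C) :
    ∃ c > 0, ∃ B₀ ≥ 0, (∀ u v t, c * u ^ 2 - B₀ ≤ lam * u ^ 2 + μ * h (u, v, t)) ∧
      ∀ v t, μ * h (0, v, t) ≤ B₀ := by
  rcases hshape with ⟨B, hB⟩ | rfl
  · have hB0 : 0 ≤ B := (abs_nonneg _).trans (hB 0)
    have key : ∀ x, |μ * h x| ≤ |μ| * B := fun x => by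
      rw [abs_mul]; exact mul_le_mul_of_nonneg_left (hB x) (abs_nonneg _)
    refine ⟨lam, hlam, |μ| * B, by positivity, fun u v t => ?_, fun v t => ?_⟩
    · have := (abs_le.1 (key (u, v, t))).1; linarith
    · exact (abs_le.1 (key (0, v, t))).2
  · have h2 := two_le_hess C hhess
    refine ⟨lam / 2, by positivity, 0, le_rfl, fun u v t => ?_, fun v t => by simp⟩
    have : lam / C ≤ lam / 2 := div_le_div_of_nonneg_left hlam.le two_pos h2
    have := (abs_le.1 (hμ.trans this)).1
    simp only
    nlinarith [sq_nonneg u]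

lemma det_bound (n d : ℕ) (hn : 0 < n) (hd : 0 < d) (lam μ : ℝ) (h : ℝ × ℝ × ℝ → ℝ)
    (c B₀ : ℝ) (hc : 0 < c)
    (hp : ∀ u v t, c * u ^ 2 - B₀ ≤ lam * u ^ 2 + μ * h (u, v, t))
    (hz : ∀ v t, μ * h (0, v, t) ≤ B₀)
    (v t u : Fin d → ℝ) (X : Fin n → Fin d → ℝ) (e : Fin n → ℝ) (R : ℝ)
    (hR : ∑ i, ((∑ k, X i k * ((1 / Real.sqrt d) * t k)) + e i) ^ 2 ≤ n * R)
    (hmin : IsMinOn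
      (fun u : Fin d → ℝ =>
        (1 / (n : ℝ)) * ∑ i,
          ((1 / Real.sqrt d) * ∑ k, X i k * t k + e i
            - (1 / Real.sqrt d) * ∑ k, X i k * (u k * v k)) ^ 2
        + (lam / (d : ℝ)) * ∑ k, u k ^ 2
        + (μ / (d : ℝ)) * ∑ k, h (u k, v k, t k))
      Set.univ u) :
    (∑ i, ((1 / Real.sqrt n) * (e i
      - ∑ k, X i k * ((1 / Real.sqrt d) * (u k * v k - t k)))) ^ 2)
      + c * ((d : ℝ)⁻¹ * ∑ k, u k ^ 2) ≤ R + 2 * B₀ := by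
  have hn' : (0 : ℝ) < n := by exact_mod_cast hn
  have hd' : (0 : ℝ) < d := by exact_mod_cast hd
  have h0 := hmin (Set.mem_univ (0 : Fin d → ℝ))
  simp only [Set.mem_ofPred_eq, Pi.zero_apply, zero_mul, mul_zero, Finset.sum_const_zero, sub_zero,
    ne_eq, OfNat.ofNat_ne_zero, not_false_eq_true, zero_pow, add_zero] at h0
  have e1 : (∑ i, ((1 / Real.sqrt n) * (e i
      - ∑ k, X i k * ((1 / Real.sqrt d) * (u k * v k - t k)))) ^ 2) =
      (1 / (n : ℝ)) * ∑ i,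
          ((1 / Real.sqrt d) * ∑ k, X i k * t k + e i
            - (1 / Real.sqrt d) * ∑ k, X i k * (u k * v k)) ^ 2 := by
    rw [Finset.mul_sum]
    refine Finset.sum_congr rfl fun i _ => ?_
    rw [mul_pow, div_pow, one_pow, Real.sq_sqrt hn'.le]
    congr 2
    have : ∑ k, X i k * ((1 / Real.sqrt d) * (u k * v k - t k)) =
        (1 / Real.sqrt d) * ∑ k, X i k * (u k * v k) - (1 / Real.sqrt d) * ∑ k, X i k * t k := by
      rw [Finset.mul_sum, Finset.mul_sum, ← Finset.sum_sub_distrib]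
      exact Finset.sum_congr rfl fun k _ => by ring
    rw [this]; ring
  have e2 : (1 / (n : ℝ)) * ∑ i, ((1 / Real.sqrt d) * ∑ k, X i k * t k + e i) ^ 2 ≤ R := by
    have : ∀ i, ∑ k, X i k * ((1 / Real.sqrt d) * t k) = (1 / Real.sqrt d) * ∑ k, X i k * t k :=
      fun i => by rw [Finset.mul_sum]; exact Finset.sum_congr rfl fun k _ => by ring
    simp only [this] at hR
    rw [one_div, inv_mul_le_iff₀ hn']
    exact hR
  have e3 : c * ((d : ℝ)⁻¹ * ∑ k, u k ^ 2) - B₀ ≤ (lam / (d : ℝ)) * ∑ k, u k ^ 2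
        + (μ / (d : ℝ)) * ∑ k, h (u k, v k, t k) := by
    have : ∑ k, (c * u k ^ 2 - B₀) ≤ ∑ k, (lam * u k ^ 2 + μ * h (u k, v k, t k)) :=
      Finset.sum_le_sum fun k _ => hp _ _ _
    rw [Finset.sum_sub_distrib, Finset.sum_add_distrib, ← Finset.mul_sum, ← Finset.mul_sum,
      ← Finset.mul_sum] at this
    simp only [Finset.sum_const, Finset.card_univ, Fintype.card_fin, nsmul_eq_mul] at this
    have := mul_le_mul_of_nonneg_left this (inv_nonneg.2 hd'.le)
    calc _ = (d : ℝ)⁻¹ * (c * ∑ k, u k ^ 2 - d * B₀) := by field_simp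
      _ ≤ _ := this
      _ = _ := by ring
  have e4 : (μ / (d : ℝ)) * ∑ k, h (0, v k, t k) ≤ B₀ := by
    have : ∑ k, μ * h (0, v k, t k) ≤ ∑ k : Fin d, B₀ := Finset.sum_le_sum fun k _ => hz _ _
    rw [← Finset.mul_sum] at this
    simp only [Finset.sum_const, Finset.card_univ, Fintype.card_fin, nsmul_eq_mul] at this
    rw [div_mul_eq_mul_div, div_le_iff₀ hd']
    linarith
  rw [e1]
  linarith

lemma delta_bound (d : ℕ) (v t u : Fin d → ℝ) (V : ℝ) (hV : ∀ k, |v k| ≤ V) :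
    ∑ k, ((1 / Real.sqrt d) * (u k * v k - t k)) ^ 2
      ≤ 2 * V ^ 2 * ((d : ℝ)⁻¹ * ∑ k, u k ^ 2) + 2 * ((d : ℝ)⁻¹ * ∑ k, t k ^ 2) := by
  have hd' : (0 : ℝ) ≤ (d : ℝ)⁻¹ := by positivity
  have : ∀ k, ((1 / Real.sqrt d) * (u k * v k - t k)) ^ 2
      ≤ 2 * V ^ 2 * ((d : ℝ)⁻¹ * u k ^ 2) + 2 * ((d : ℝ)⁻¹ * t k ^ 2) := fun k => by
    rw [mul_pow, div_pow, one_pow, Real.sq_sqrt (Nat.cast_nonneg d), one_div]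
    have hv : v k ^ 2 ≤ V ^ 2 := sq_le_sq' (abs_le.1 (hV k)).1 (abs_le.1 (hV k)).2
    have h1 : (u k * v k - t k) ^ 2 ≤ 2 * V ^ 2 * u k ^ 2 + 2 * t k ^ 2 := by
      nlinarith [sq_nonneg (u k * v k + t k), mul_le_mul_of_nonneg_left hv (sq_nonneg (u k))]
    calc _ ≤ _ := mul_le_mul_of_nonneg_left h1 hd'
      _ = _ := by ring
  refine (Finset.sum_le_sum fun k _ => this k).trans (le_of_eq ?_)
  rw [Finset.sum_add_distrib]
  simp only [Finset.mul_sum]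

/-- For the perturbed ridge problem
`P₁(μ) = min_u (1/n)‖y − (1/√d)X(u ⊙ v)‖₂² + (λ/d)‖u‖₂² + (μ/d)∑ᵢ h(uᵢ, vᵢ, θ*ᵢ)`,
with `h` twice continuously differentiable with uniformly bounded Hessian `‖∇²h‖ ≤ C`, `h`
bounded or `h(u,v,θ) = u²`, and `|μ| ≤ λ/C` (so the objective is strongly convex with unique
minimizer `u*`), setting `Δ* = (1/√d)(u* ⊙ v − θ*)` and `q* = (1/√n)(ε − XΔ*)`, there is a
constant `C₁ > 0` (independent of `d`) such that, as `n, d → ∞` with `d/n = κ` fixed,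
`P{‖Δ*‖₂ ≤ C₁(1 + ‖v‖_∞)} → 1` and `P{‖q*‖₂ ≤ C₁(1 + ‖v‖_∞)} → 1`. -/
theorem perturbed_ridge_solution_norm_bounds
    (κ : ℝ) (hκ : 0 < κ) (σ : ℝ≥0) (lam : ℝ) (hlam : 0 < lam)
    (n d : ℕ → ℕ) (hn : Tendsto n atTop atTop) (hd : Tendsto d atTop atTop)
    (hratio : ∀ j, (d j : ℝ) / (n j : ℝ) = κ)
    (v θstar : (j : ℕ) → Fin (d j) → ℝ)
    (hvne : ∀ j i, v j i ≠ 0)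
    (Pit : Measure (ℝ × ℝ)) (hPitProb : IsProbabilityMeasure Pit)
    (hW2 : ∀ g : ℝ × ℝ → ℝ, PseudoLipschitz2Pair g →
      Tendsto (fun j => (d j : ℝ)⁻¹ * ∑ i, g (v j i, θstar j i)) atTop
        (𝓝 (∫ p, g p ∂Pit)))
    (h : ℝ × ℝ × ℝ → ℝ) (C : ℝ) (hC : 0 < C)
    (hsmooth : ContDiff ℝ 2 h)
    (hhess : ∀ x, ‖iteratedFDeriv ℝ 2 h x‖ ≤ C)
    (hshape : (∃ B : ℝ, ∀ x, |h x| ≤ B) ∨ h = fun x => x.1 ^ 2)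
    (μ : ℝ) (hμ : |μ| ≤ lam / C)
    (ustar : (j : ℕ) → (Fin (n j) → Fin (d j) → ℝ) × (Fin (n j) → ℝ) → Fin (d j) → ℝ)
    (hmin : ∀ j ω, IsMinOn
      (fun u : Fin (d j) → ℝ =>
        (1 / (n j : ℝ)) * ∑ i,
          ((1 / Real.sqrt (d j)) * ∑ k, ω.1 i k * θstar j k + ω.2 i
            - (1 / Real.sqrt (d j)) * ∑ k, ω.1 i k * (u k * v j k)) ^ 2
        + (lam / (d j : ℝ)) * ∑ k, u k ^ 2
        + (μ / (d j : ℝ)) * ∑ k, h (u k, v j k, θstar j k))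
      Set.univ (ustar j ω)) :
    ∃ C₁ > (0 : ℝ),
      Tendsto (fun j =>
        batchMeasure (n j) (d j) σ
          {ω | Real.sqrt (∑ k, ((1 / Real.sqrt (d j)) * (ustar j ω k * v j k - θstar j k)) ^ 2)
            ≤ C₁ * (1 + ⨆ i, |v j i|)})
        atTop (𝓝 (1 : ℝ≥0∞)) ∧
      Tendsto (fun j =>
        batchMeasure (n j) (d j) σ
          {ω | Real.sqrt (∑ i,
              ((1 / Real.sqrt (n j)) * (ω.2 i
                - ∑ k, ω.1 i k * ((1 / Real.sqrt (d j)) * (ustar j ω k * v j k - θstar j k)))) ^ 2)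
            ≤ C₁ * (1 + ⨆ i, |v j i|)})
        atTop (𝓝 (1 : ℝ≥0∞)) := by
  obtain ⟨c, hc, B₀, hB₀, hp, hz⟩ := penalty_bound lam hlam h C hC hhess hshape μ hμ
  set M : ℝ := |∫ p : ℝ × ℝ, p.2 ^ 2 ∂Pit| + 1 with hMdef
  have hM0 : 0 ≤ M := by positivity
  have hM : ∀ᶠ j in atTop, (d j : ℝ)⁻¹ * ∑ k, θstar j k ^ 2 ≤ M := by
    have := hW2 _ pl_sq_snd
    refine (this.eventually_lt_const (u := M) ?_).mono fun j hj => hj.le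
    have := le_abs_self (∫ p : ℝ × ℝ, p.2 ^ 2 ∂Pit)
    linarith
  set R : ℝ := 4 * (M + (σ : ℝ) ^ 2) with hRdef
  have hR0 : 0 ≤ R := by positivity
  set T : ℝ := R + 2 * B₀ with hTdef
  have hT0 : 0 ≤ T := by positivity
  have hnpos : ∀ j, 0 < n j := fun j => by
    rcases Nat.eq_zero_or_pos (n j) with h0 | h0
    · have := hratio j; rw [h0] at this; simp at this; exact absurd this hκ.ne
    · exact h0
  have hdpos : ∀ j, 0 < d j := fun j => by
    rcases Nat.eq_zero_or_pos (d j) with h0 | h0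
    · have := hratio j; rw [h0] at this; simp at this; exact absurd this hκ.ne
    · exact h0
  set S : ℝ := T + 2 * (T / c) + 2 * M with hSdef
  have hTc : 0 ≤ T / c := by positivity
  have hS0 : 0 ≤ S := by positivity
  have hprob : ∀ j, IsProbabilityMeasure (batchMeasure (n j) (d j) σ) := fun j => by
    unfold batchMeasure; infer_instance
  -- the good event
  let G : (j : ℕ) → Set ((Fin (n j) → Fin (d j) → ℝ) × (Fin (n j) → ℝ)) := fun j =>
    {ω | ∑ i, ((∑ k, ω.1 i k * ((1 / Real.sqrt (d j)) * θstar j k)) + ω.2 i) ^ 2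
      ≤ 4 * (n j : ℝ) * ((∑ k, ((1 / Real.sqrt (d j)) * θstar j k) ^ 2) + (σ : ℝ) ^ 2)}
  have hGm : ∀ j, MeasurableSet (G j) := fun j =>
    measurableSet_le (by fun_prop) (by fun_prop)
  have hGlow : ∀ j, 1 - (pbad (n j) + pbad (n j)) ≤ batchMeasure (n j) (d j) σ (G j) := fun j => by
    have hb := bad_batch (n j) (d j) σ (fun k => (1 / Real.sqrt (d j)) * θstar j k)
    have hcompl : (G j)ᶜ = {ω | 4 * (n j : ℝ) *
        ((∑ k, ((1 / Real.sqrt (d j)) * θstar j k) ^ 2) + (σ : ℝ) ^ 2) <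
        ∑ i, ((∑ k, ω.1 i k * ((1 / Real.sqrt (d j)) * θstar j k)) + ω.2 i) ^ 2} := by
      ext ω; simp only [G, Set.mem_compl_iff, Set.mem_ofPred_eq, not_le]
    rw [← hcompl, prob_compl_eq_one_sub (hGm j)] at hb
    rw [tsub_le_iff_right] at hb ⊢
    rwa [add_comm]
  have hlim : Tendsto (fun j => 1 - (pbad (n j) + pbad (n j))) atTop (𝓝 (1 : ℝ≥0∞)) := by
    have h1 := tendsto_pbad.comp hn
    have := ENNReal.Tendsto.sub (tendsto_const_nhds (x := (1 : ℝ≥0∞))) (h1.add h1)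
      (Or.inl (by simp))
    simpa using this
  have main : ∀ E : (j : ℕ) → Set ((Fin (n j) → Fin (d j) → ℝ) × (Fin (n j) → ℝ)),
      (∀ᶠ j in atTop, G j ⊆ E j) →
      Tendsto (fun j => batchMeasure (n j) (d j) σ (E j)) atTop (𝓝 (1 : ℝ≥0∞)) := fun E hE =>
    tendsto_of_tendsto_of_tendsto_of_le_of_le' hlim tendsto_const_nhds
      (hE.mono fun j hj => (hGlow j).trans (measure_mono hj))
      (Eventually.of_forall fun j => prob_le_one)
  have hdet : ∀ᶠ j in atTop, ∀ ω ∈ G j,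
      (∑ i, ((1 / Real.sqrt (n j)) * (ω.2 i
        - ∑ k, ω.1 i k * ((1 / Real.sqrt (d j)) * (ustar j ω k * v j k - θstar j k)))) ^ 2)
      + c * ((d j : ℝ)⁻¹ * ∑ k, ustar j ω k ^ 2) ≤ T := by
    filter_upwards [hM] with j hj ω hω
    refine det_bound (n j) (d j) (hnpos j) (hdpos j) lam μ h c B₀ hc hp hz (v j) (θstar j)
      (ustar j ω) ω.1 ω.2 R ?_ (hmin j ω)
    refine le_trans hω ?_
    have : ∑ k, ((1 / Real.sqrt (d j)) * θstar j k) ^ 2 = (d j : ℝ)⁻¹ * ∑ k, θstar j k ^ 2 := by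
      rw [Finset.mul_sum]
      refine Finset.sum_congr rfl fun k _ => ?_
      rw [mul_pow, div_pow, one_pow, Real.sq_sqrt (Nat.cast_nonneg _), one_div]
    rw [this, hRdef]
    have : (0 : ℝ) ≤ n j := Nat.cast_nonneg _
    nlinarith [mul_le_mul_of_nonneg_left hj this]
  have hVb : ∀ j k, |v j k| ≤ ⨆ i, |v j i| := fun j k =>
    le_ciSup (f := fun i => |v j i|) (Set.finite_range _).bddAbove k
  have hV0 : ∀ j, 0 ≤ ⨆ i, |v j i| := fun j => Real.iSup_nonneg fun i => abs_nonneg _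
  have hsq : (Real.sqrt S + 1) ^ 2 ≥ S := by
    nlinarith [Real.sq_sqrt hS0, Real.sqrt_nonneg S]
  refine ⟨Real.sqrt S + 1, by positivity, main _ ?_, main _ ?_⟩
  · filter_upwards [hdet, hM] with j hj hMj ω hω
    have h1 := hj ω hω
    have hq : 0 ≤ ∑ i, ((1 / Real.sqrt (n j)) * (ω.2 i
        - ∑ k, ω.1 i k * ((1 / Real.sqrt (d j)) * (ustar j ω k * v j k - θstar j k)))) ^ 2 :=
      Finset.sum_nonneg fun _ _ => sq_nonneg _
    have hu : (d j : ℝ)⁻¹ * ∑ k, ustar j ω k ^ 2 ≤ T / c := by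
      rw [le_div_iff₀ hc]; linarith
    have hD := delta_bound (d j) (v j) (θstar j) (ustar j ω) _ (hVb j)
    have hV := hV0 j
    set V := ⨆ i, |v j i|
    refine Real.sqrt_le_iff.2 ⟨by positivity, hD.trans ?_⟩
    rw [mul_pow]
    have h2 : S * (1 + V) ^ 2 ≤ (Real.sqrt S + 1) ^ 2 * (1 + V) ^ 2 :=
      mul_le_mul_of_nonneg_right hsq (sq_nonneg _)
    refine le_trans ?_ h2
    have h3 : 2 * V ^ 2 * ((d j : ℝ)⁻¹ * ∑ k, ustar j ω k ^ 2) ≤ 2 * V ^ 2 * (T / c) :=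
      mul_le_mul_of_nonneg_left hu (by positivity)
    have h4 : V ^ 2 * (2 * (T / c)) ≤ (1 + V) ^ 2 * (2 * (T / c)) :=
      mul_le_mul_of_nonneg_right (by nlinarith) (by positivity)
    have h5 : 1 * (2 * M) ≤ (1 + V) ^ 2 * (2 * M) :=
      mul_le_mul_of_nonneg_right (by nlinarith) (by positivity)
    have h6 : 0 ≤ (1 + V) ^ 2 * T := by positivity
    have : S * (1 + V) ^ 2 = (1 + V) ^ 2 * T + (1 + V) ^ 2 * (2 * (T / c))
      + (1 + V) ^ 2 * (2 * M) := by rw [hSdef]; ring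
    linarith
  · filter_upwards [hdet] with j hj ω hω
    have h1 := hj ω hω
    have hu : 0 ≤ c * ((d j : ℝ)⁻¹ * ∑ k, ustar j ω k ^ 2) := by positivity
    have hV := hV0 j
    set V := ⨆ i, |v j i|
    refine Real.sqrt_le_iff.2 ⟨by positivity, ?_⟩
    rw [mul_pow]
    have h2 : S * 1 ≤ (Real.sqrt S + 1) ^ 2 * (1 + V) ^ 2 :=
      mul_le_mul hsq (by nlinarith) zero_le_one (sq_nonneg _)
    have : T ≤ S := by rw [hSdef]; linarith
    linarith
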